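/- Shifted cubical complexes are Laplacian integral: Let X ⊆ Q_n be a shifted cubical complex. Then for every k ≥ 0, every eigenvalue of the real symmetric matrix L^ud_k(X), and every eigenvalue of L^tot_k(X), is an integer (equivalently, the characteristic polynomials of these Laplacians split over ℤ). -/

import Mathlib

open BigOperators Matrix

namespace CubicalPaper

/-- Faces of the `n`-cube `Q_n`: tuples in `{0, 1, ✱}ⁿ`, with `2 : Fin 3` playing the
role of `✱`. -/
abbrev Face (n : ℕ) : Type := Fin n → Fin 3

/-- The direction set of a face: the coordinates equal to `✱`. -/
def dir {n : ℕ} (f : Face n) : Finset (Fin n) := Finset.univ.filter fun i => f i = 2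

/-- The dimension of a face. -/
def fdim {n : ℕ} (f : Face n) : ℕ := (dir f).card

/-- The partial order on `Q_n`: `f ≤ g` iff `f i = g i` whenever `g i ≠ ✱`. -/
def cubeLE {n : ℕ} (f g : Face n) : Prop := ∀ i, g i ≠ 2 → f i = g i

/-- A proper cubical complex: a downward-closed set of faces of `Q_n`. -/
def IsComplex {n : ℕ} (X : Finset (Face n)) : Prop :=
  ∀ g ∈ X, ∀ f, cubeLE f g → f ∈ X

/-- The incidence sign `ε(f, g)`: if `dir g = {a_1 < ⋯ < a_i}` and `f` is obtained from
`g` by changing the entry `g (a_j) = ✱` to `0` (resp. `1`), then `ε(f,g) = (-1)^j`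
(resp. `(-1)^(j+1)`); in all other cases `ε(f,g) = 0`. -/
def eps {n : ℕ} (f g : Face n) : ℤ :=
  ∑ a : Fin n,
    if g a = 2 ∧ f a ≠ 2 ∧ ∀ b, b ≠ a → f b = g b then
      (-1 : ℤ) ^ ((Finset.univ.filter fun b => g b = 2 ∧ b ≤ a).card +
        if f a = 1 then 1 else 0)
    else 0

/-- The `k`-dimensional faces of `X`. -/
def faceSet {n : ℕ} (X : Finset (Face n)) (k : ℕ) : Finset (Face n) :=
  X.filter fun f => fdim f = k

/-- The real cubical boundary matrix `∂_{k+1}` of `X`, with rows indexed by `X_k`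
and columns by `X_{k+1}`, entries `ε(f, g)`. -/
def bdryM {n : ℕ} (X : Finset (Face n)) (k : ℕ) :
    Matrix {f // f ∈ faceSet X k} {g // g ∈ faceSet X (k + 1)} ℝ :=
  Matrix.of fun f g => (eps f.1 g.1 : ℝ)

/-- The up-down Laplacian `L^ud_k = ∂_{k+1} ∂_{k+1}^T`. -/
noncomputable def Lud {n : ℕ} (X : Finset (Face n)) (k : ℕ) :
    Matrix {f // f ∈ faceSet X k} {f // f ∈ faceSet X k} ℝ :=
  bdryM X k * (bdryM X k)ᵀ

/-- The down-up Laplacian `L^du_k = ∂_k^T ∂_k` (with `∂_0 = 0`). -/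
noncomputable def Ldu {n : ℕ} (X : Finset (Face n)) :
    (k : ℕ) → Matrix {f // f ∈ faceSet X k} {f // f ∈ faceSet X k} ℝ
  | 0 => 0
  | (j + 1) => (bdryM X j)ᵀ * bdryM X j

/-- The total Laplacian `L^tot_k = L^ud_k + L^du_k`. -/
noncomputable def Ltot {n : ℕ} (X : Finset (Face n)) (k : ℕ) :
    Matrix {f // f ∈ faceSet X k} {f // f ∈ faceSet X k} ℝ :=
  Lud X k + Ldu X k

/-- The spectrum `s^tot_k(X)` of `L^tot_k`: the multiset of roots of its characteristic
polynomial (all of which are real, `L^tot_k` being real symmetric). -/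
noncomputable def stot {n : ℕ} (X : Finset (Face n)) (k : ℕ) : Multiset ℝ :=
  (Ltot X k).charpoly.roots

/-- The spectrum `s^ud_k(X)` of `L^ud_k`. -/
noncomputable def sud {n : ℕ} (X : Finset (Face n)) (k : ℕ) : Multiset ℝ :=
  (Lud X k).charpoly.roots

/-- A shifted cubical complex: a proper cubical complex `X ⊆ Q_n` containing the full
`1`-skeleton, closed under changing a face to any face with the same direction set, and
closed under componentwise decrease of the increasingly-ordered direction set. -/
def IsShifted {n : ℕ} (X : Finset (Face n)) : Prop :=
  IsComplex X ∧
    (∀ f : Face n, fdim f ≤ 1 → f ∈ X) ∧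
    (∀ f g : Face n, fdim f = fdim g → f ∈ X → dir f = dir g → g ∈ X) ∧
    (∀ f g : Face n, fdim f = fdim g → g ∈ X →
      List.Forall₂ (· ≤ ·) ((dir f).sort (· ≤ ·)) ((dir g).sort (· ≤ ·)) → f ∈ X)

section Incidence

variable {n : ℕ}

lemma dir_cons_two (f : Face n) :
    dir (Fin.cons 2 f : Face (n + 1)) = insert 0 ((dir f).map (Fin.succEmb n)) := by
  ext i
  refine Fin.cases ?_ (fun i => ?_) i <;> simp [dir]

lemma dir_cons_of_ne_two {a : Fin 3} (ha : a ≠ 2) (f : Face n) :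
    dir (Fin.cons a f : Face (n + 1)) = (dir f).map (Fin.succEmb n) := by
  ext i
  refine Fin.cases ?_ (fun i => ?_) i <;> simp [dir, ha]

lemma eps_cons (a b : Fin 3) (f g : Face n) :
    eps (Fin.cons a f : Face (n + 1)) (Fin.cons b g) =
      (if a = b then (if a = 2 then -1 else 1) * eps f g else 0) +
      (if b = 2 ∧ a ≠ 2 ∧ f = g then (if a = 1 then 1 else -1) else 0) := by
  have hcard : ∀ i : Fin n, (Finset.univ.filter fun j : Fin (n + 1) =>
      (Fin.cons b g : Face (n + 1)) j = 2 ∧ j ≤ i.succ).card =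
      (if b = 2 then 1 else 0) + (Finset.univ.filter fun j => g j = 2 ∧ j ≤ i).card := by
    intro i
    rw [Fin.card_filter_univ_succ]
    simp only [Fin.cons_zero, Fin.zero_le, and_true, Fin.cons_succ,
      Fin.succ_le_succ_iff]
    split_ifs <;> omega
  have hcard0 : b = 2 → (Finset.univ.filter fun j : Fin (n + 1) =>
      (Fin.cons b g : Face (n + 1)) j = 2 ∧ j ≤ 0).card = 1 := by
    intro hb
    rw [Fin.card_filter_univ_succ]
    simp [hb, Fin.ext_iff]
  unfold eps
  rw [Fin.sum_univ_succ, add_comm]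
  congr 1
  · simp only [hcard, Fin.cons_succ, Fin.forall_fin_succ, Fin.cons_zero, Fin.succ_inj, ne_eq,
      (Fin.succ_ne_zero _).symm, not_false_eq_true, forall_const]
    by_cases hab : a = b
    · subst hab
      rw [if_pos rfl, Finset.mul_sum]
      refine Finset.sum_congr rfl fun i _ => ?_
      by_cases h2 : a = 2 <;> simp [h2, pow_add]
    · simp [hab]
  · have hfg : (∀ i : Fin (n + 1), i ≠ 0 →
        (Fin.cons a f : Face (n + 1)) i = (Fin.cons b g : Face (n + 1)) i) ↔ f = g := by
      simp [Fin.forall_fin_succ, funext_iff]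
    simp only [Fin.cons_zero, hfg, ne_eq]
    by_cases h : b = 2 ∧ ¬ a = 2 ∧ f = g
    · rw [if_pos h, if_pos h, hcard0 h.1]
      split_ifs <;> simp
    · rw [if_neg h, if_neg h]

lemma dir_eq_erase_of_eps_ne_zero {f g : Face n} (h : eps f g ≠ 0) :
    ∃ a ∈ dir g, dir f = (dir g).erase a := by
  obtain ⟨a, -, ha⟩ := Finset.exists_ne_zero_of_sum_ne_zero h
  have h' := (ite_ne_right_iff.mp ha).1
  refine ⟨a, by simp [dir, h'.1], ?_⟩
  ext b
  by_cases hb : b = a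
  · subst hb
    simp [dir, h'.2.1]
  · simp [dir, hb, h'.2.2 b hb]

lemma cubeLE_of_eps_ne_zero {f g : Face n} (h : eps f g ≠ 0) : cubeLE f g := by
  obtain ⟨a, -, ha⟩ := Finset.exists_ne_zero_of_sum_ne_zero h
  have h' := (ite_ne_right_iff.mp ha).1
  intro b hb
  exact h'.2.2 b (by rintro rfl; exact hb h'.1)

lemma fdim_of_eps_ne_zero {f g : Face n} (h : eps f g ≠ 0) : fdim g = fdim f + 1 := by
  obtain ⟨a, ha, hf⟩ := dir_eq_erase_of_eps_ne_zero h
  rw [fdim, fdim, hf, Finset.card_erase_add_one ha]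

lemma sum_face_succ {M : Type*} [AddCommMonoid M] (F : Face (n + 1) → M) :
    ∑ f, F f = (∑ f : Face n, F (Fin.cons 0 f)) + (∑ f : Face n, F (Fin.cons 1 f)) +
      ∑ f : Face n, F (Fin.cons 2 f) := by
  rw [← (Fin.consEquiv fun _ : Fin (n + 1) => Fin 3).sum_comp, Fintype.sum_prod_type,
    Fin.sum_univ_three]
  rfl

end Incidence

/-- The boundary matrix of the whole cube, in all dimensions at once. -/
def bdryMatrix (n : ℕ) : Matrix (Face n) (Face n) ℝ :=
  Matrix.of fun f g => (eps f g : ℝ)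

open Classical in
/-- The orthogonal projection onto the span of the faces with direction set in `K`. -/
noncomputable def dirProj {n : ℕ} (K : Set (Finset (Fin n))) : Matrix (Face n) (Face n) ℝ :=
  Matrix.diagonal fun f => if dir f ∈ K then 1 else 0

section Blocks

variable {n : ℕ} (c : Face (n + 1) → ℝ)

lemma bdryMatrix_mulVec_cons (a : Fin 3) :
    (fun f : Face n => (bdryMatrix (n + 1) *ᵥ c) (Fin.cons a f)) =
      (if a = 2 then -1 else 1 : ℝ) • (bdryMatrix n *ᵥ fun f => c (Fin.cons a f)) +
      (if a = 2 then 0 else if a = 1 then 1 else -1 : ℝ) • fun f => c (Fin.cons 2 f) := by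
  funext f
  simp only [mulVec, dotProduct, bdryMatrix, of_apply, sum_face_succ, eps_cons, Pi.add_apply,
    Pi.smul_apply, smul_eq_mul, Finset.mul_sum]
  fin_cases a <;> simp

lemma bdryMatrix_transpose_mulVec_cons (a : Fin 3) :
    (fun f : Face n => ((bdryMatrix (n + 1))ᵀ *ᵥ c) (Fin.cons a f)) =
      (if a = 2 then -1 else 1 : ℝ) • ((bdryMatrix n)ᵀ *ᵥ fun f => c (Fin.cons a f)) +
      (if a = 2 then 1 else 0 : ℝ) •
        ((fun f => c (Fin.cons 1 f)) - fun f => c (Fin.cons 0 f)) := by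
  funext f
  simp only [mulVec, dotProduct, bdryMatrix, of_apply, sum_face_succ, eps_cons, Pi.add_apply,
    Pi.smul_apply, smul_eq_mul, Finset.mul_sum, transpose_apply, Pi.sub_apply]
  fin_cases a
  · simp
  · simp
  · simp
    ring

lemma dirProj_mulVec_cons_two (K : Set (Finset (Fin (n + 1)))) :
    (fun f : Face n => (dirProj K *ᵥ c) (Fin.cons 2 f)) =
      dirProj {S | insert 0 (S.map (Fin.succEmb n)) ∈ K} *ᵥ fun f => c (Fin.cons 2 f) := by
  classical
  funext f
  simp only [dirProj, mulVec_diagonal]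
  congr 1
  exact if_congr (by rw [dir_cons_two]; rfl) rfl rfl

lemma dirProj_mulVec_cons_of_ne_two (K : Set (Finset (Fin (n + 1)))) {a : Fin 3} (ha : a ≠ 2) :
    (fun f : Face n => (dirProj K *ᵥ c) (Fin.cons a f)) =
      dirProj {S | S.map (Fin.succEmb n) ∈ K} *ᵥ fun f => c (Fin.cons a f) := by
  classical
  funext f
  simp only [dirProj, mulVec_diagonal]
  congr 1
  exact if_congr (by rw [dir_cons_of_ne_two ha]; rfl) rfl rfl

end Blocks

lemma bdryMatrix_mul_self (n : ℕ) : bdryMatrix n * bdryMatrix n = 0 := by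
  induction n with
  | zero => ext f g; simp [Matrix.mul_apply, bdryMatrix, eps]
  | succ n ih =>
    have ih' (v : Face n → ℝ) : bdryMatrix n *ᵥ bdryMatrix n *ᵥ v = 0 := by
      rw [mulVec_mulVec, ih, zero_mulVec]
    refine Matrix.ext_of_mulVec_single fun g => ?_
    generalize (Pi.single g 1 : Face (n + 1) → ℝ) = v
    rw [zero_mulVec, ← mulVec_mulVec]
    have h : ∀ a : Fin 3, (fun f : Face n =>
        (bdryMatrix (n + 1) *ᵥ bdryMatrix (n + 1) *ᵥ v) (Fin.cons a f)) = 0 := by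
      intro a
      rw [bdryMatrix_mulVec_cons, bdryMatrix_mulVec_cons, bdryMatrix_mulVec_cons]
      fin_cases a <;> simp [mulVec_add, mulVec_neg, ih']
    funext f
    rw [← Fin.cons_self_tail f]
    exact congrFun (h (f 0)) (Fin.tail f)

section Projection

variable {n : ℕ} {D L : Set (Finset (Fin n))}

lemma dirProj_transpose (K : Set (Finset (Fin n))) : (dirProj K)ᵀ = dirProj K :=
  diagonal_transpose _

lemma dirProj_mul_self (K : Set (Finset (Fin n))) : dirProj K * dirProj K = dirProj K := by
  simp [dirProj, diagonal_mul_diagonal]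

lemma dirProj_mul_bdryMatrix_mul_dirProj (h : ∀ S ∈ D, ∀ a ∈ S, S.erase a ∈ L) :
    dirProj L * (bdryMatrix n * dirProj D) = bdryMatrix n * dirProj D := by
  ext f g
  simp only [dirProj, diagonal_mul, mul_diagonal, bdryMatrix, of_apply]
  by_cases hf : dir f ∈ L
  · simp [hf]
  · by_cases hg : dir g ∈ D
    · have : eps f g = 0 := by
        by_contra he
        obtain ⟨a, ha, hfa⟩ := dir_eq_erase_of_eps_ne_zero he
        exact hf (hfa ▸ h _ hg a ha)
      simp [this]
    · simp [hg]

lemma dirProj_mul_transpose_mul_dirProj (h : ∀ S ∈ D, ∀ a ∈ S, S.erase a ∈ L) :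
    dirProj D * (bdryMatrix n)ᵀ * dirProj L = dirProj D * (bdryMatrix n)ᵀ := by
  have := congrArg transpose (dirProj_mul_bdryMatrix_mul_dirProj h)
  simpa only [transpose_mul, dirProj_transpose] using this

end Projection

/-- The up-down Laplacian, on all faces of the cube, of the faces with direction set in `K`. -/
noncomputable def dirLaplacian {n : ℕ} (K : Set (Finset (Fin n))) :
    Matrix (Face n) (Face n) ℝ :=
  bdryMatrix n * dirProj K * (bdryMatrix n)ᵀ

/-- The up-down Laplacian of `D` plus the down-up Laplacian of `L` on vectors supported on `L`:
its eigenvalues come from those of the two up-down Laplacians. -/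
lemma eigenvalue_of_dirLaplacian_add {n : ℕ} {D L : Set (Finset (Fin n))}
    (hDL : ∀ S ∈ D, ∀ a ∈ S, S.erase a ∈ L) {w : Face n → ℝ} {μ : ℝ} (hw : w ≠ 0)
    (h : dirLaplacian D *ᵥ w + dirProj L *ᵥ (bdryMatrix n)ᵀ *ᵥ bdryMatrix n *ᵥ w = μ • w) :
    μ = 0 ∨ (∃ v, v ≠ 0 ∧ dirLaplacian D *ᵥ v = μ • v) ∨
      ∃ v, v ≠ 0 ∧ dirLaplacian L *ᵥ v = μ • v := by
  have hAB : dirLaplacian D * (dirProj L * (bdryMatrix n)ᵀ) = 0 := by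
    have h2 := congrArg transpose (bdryMatrix_mul_self n)
    rw [transpose_mul, transpose_zero] at h2
    calc dirLaplacian D * (dirProj L * (bdryMatrix n)ᵀ)
        = bdryMatrix n * (dirProj D * (bdryMatrix n)ᵀ * dirProj L) * (bdryMatrix n)ᵀ := by
          simp only [dirLaplacian, Matrix.mul_assoc]
      _ = bdryMatrix n * dirProj D * ((bdryMatrix n)ᵀ * (bdryMatrix n)ᵀ) := by
          rw [dirProj_mul_transpose_mul_dirProj hDL]; simp only [Matrix.mul_assoc]
      _ = 0 := by rw [h2, Matrix.mul_zero]
  by_cases hA : dirLaplacian D *ᵥ w = 0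
  · by_cases hμ : μ = 0
    · exact Or.inl hμ
    rw [hA, zero_add] at h
    refine Or.inr (Or.inr ⟨bdryMatrix n *ᵥ w, fun h0 => ?_, ?_⟩)
    · rw [h0, mulVec_zero, mulVec_zero] at h
      exact (smul_ne_zero hμ hw) h.symm
    · have := congrArg (bdryMatrix n *ᵥ ·) h
      simpa only [dirLaplacian, mulVec_mulVec, mulVec_smul, Matrix.mul_assoc] using this
  · refine Or.inr (Or.inl ⟨_, hA, ?_⟩)
    have := congrArg (dirLaplacian D *ᵥ ·) h
    simp only [mulVec_add, mulVec_smul] at this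
    rw [mulVec_mulVec _ (dirProj L), mulVec_mulVec _ (dirLaplacian D) (dirProj L * _), hAB,
      zero_mulVec, add_zero] at this
    exact this

/-- A family of sets closed under replacing an element by a smaller one. -/
def IsShiftedFamily {α : Type*} [LinearOrder α] (K : Set (Finset α)) : Prop :=
  ∀ S ∈ K, ∀ j ∈ S, ∀ i ∉ S, i < j → insert i (S.erase j) ∈ K

section Recursion

variable {n : ℕ} {K : Set (Finset (Fin (n + 1)))}

lemma IsShiftedFamily.deletion (hK : IsShiftedFamily K) :
    IsShiftedFamily {S : Finset (Fin n) | S.map (Fin.succEmb n) ∈ K} := by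
  intro S hS j hj i hi hij
  have := hK _ hS j.succ (by simpa using hj) i.succ (by simpa using hi) (by simpa using hij)
  simpa [Finset.map_insert, Finset.map_erase] using this

lemma IsShiftedFamily.link (hK : IsShiftedFamily K) :
    IsShiftedFamily {S : Finset (Fin n) | insert 0 (S.map (Fin.succEmb n)) ∈ K} := by
  intro S hS j hj i hi hij
  have := hK _ hS j.succ (by simpa using hj) i.succ (by simpa using hi) (by simpa using hij)
  rw [Finset.erase_insert_of_ne (Fin.succ_ne_zero j).symm, Finset.insert_comm] at this
  simpa [Finset.map_insert, Finset.map_erase] using this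

lemma IsShiftedFamily.erase_mem_link (hK : IsShiftedFamily K) :
    ∀ S ∈ {S : Finset (Fin n) | S.map (Fin.succEmb n) ∈ K}, ∀ a ∈ S,
      S.erase a ∈ {S : Finset (Fin n) | insert 0 (S.map (Fin.succEmb n)) ∈ K} := by
  intro S hS a ha
  have := hK _ hS a.succ (by simpa using ha) 0 (by simp) (by simp)
  simpa [Finset.map_erase] using this

lemma exists_int_of_dirLaplacian_succ (hK : IsShiftedFamily K) {c : Face (n + 1) → ℝ} {lam : ℝ}
    (hc : c ≠ 0) (h : dirLaplacian K *ᵥ c = lam • c)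
    (ih : ∀ K' : Set (Finset (Fin n)), IsShiftedFamily K' → ∀ (v : Face n → ℝ) (μ : ℝ), v ≠ 0 →
      dirLaplacian K' *ᵥ v = μ • v → ∃ m : ℤ, μ = m) :
    ∃ m : ℤ, lam = m := by
  have hDL := hK.erase_mem_link
  have hD := hK.deletion
  have hL := hK.link
  have key : ∀ a : Fin 3, (fun f : Face n => (bdryMatrix (n + 1) *ᵥ dirProj K *ᵥ
      (bdryMatrix (n + 1))ᵀ *ᵥ c) (Fin.cons a f)) = lam • fun f => c (Fin.cons a f) := by
    intro a
    rw [mulVec_mulVec, mulVec_mulVec, ← dirLaplacian, h]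
    rfl
  have h0 := key 0
  have h1 := key 1
  have h2 := key 2
  rw [bdryMatrix_mulVec_cons, dirProj_mulVec_cons_two, bdryMatrix_transpose_mulVec_cons] at h0 h1 h2
  rw [dirProj_mulVec_cons_of_ne_two _ _ (by decide), bdryMatrix_transpose_mulVec_cons] at h0 h1
  have hc' : (fun f => c (Fin.cons 0 f)) ≠ 0 ∨ (fun f => c (Fin.cons 1 f)) ≠ 0 ∨
      (fun f => c (Fin.cons 2 f)) ≠ 0 := by
    by_contra! hz
    refine hc (funext fun f => ?_)
    rw [← Fin.cons_self_tail f]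
    generalize Fin.tail f = g
    generalize f 0 = a
    fin_cases a
    exacts [congrFun hz.1 g, congrFun hz.2.1 g, congrFun hz.2.2 g]
  clear key h hc
  generalize {S : Finset (Fin n) | S.map (Fin.succEmb n) ∈ K} = D at *
  generalize {S : Finset (Fin n) | insert 0 (S.map (Fin.succEmb n)) ∈ K} = L at *
  generalize (fun f : Face n => c (Fin.cons 0 f)) = x₀ at *
  generalize (fun f : Face n => c (Fin.cons 1 f)) = x₁ at *
  generalize (fun f : Face n => c (Fin.cons 2 f)) = y at *
  simp only [reduceIte, Fin.reduceEq, one_smul, zero_smul, add_zero, neg_smul,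
    mulVec_mulVec _ (dirProj D), mulVec_mulVec _ (bdryMatrix n) (_ * _),
    ← Matrix.mul_assoc] at h0 h1 h2
  rw [← dirLaplacian] at h0 h1
  obtain ⟨w, hw⟩ : ∃ w, w = dirProj L *ᵥ (-((bdryMatrix n)ᵀ *ᵥ y) + (x₁ - x₀)) := ⟨_, rfl⟩
  rw [← hw] at h0 h1 h2
  by_cases hlam : lam = 0
  · exact ⟨0, by simpa using hlam⟩
  by_cases hu : x₀ + x₁ = 0
  swap
  · refine ih D hD (x₀ + x₁) lam hu ?_
    rw [mulVec_add, smul_add, ← h0, ← h1]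
    abel
  have hs : lam • (x₁ - x₀) = dirLaplacian D *ᵥ (x₁ - x₀) + (2 : ℝ) • w := by
    rw [smul_sub, ← h0, ← h1, mulVec_sub, two_smul]
    abel
  have hTT : (bdryMatrix n)ᵀ * (bdryMatrix n)ᵀ = 0 := by
    rw [← transpose_mul, bdryMatrix_mul_self, transpose_zero]
  have hAw : dirLaplacian D *ᵥ w = dirLaplacian D *ᵥ (x₁ - x₀) := by
    have hAL : dirLaplacian D * dirProj L = dirLaplacian D := by
      rw [dirLaplacian, Matrix.mul_assoc, Matrix.mul_assoc, ← Matrix.mul_assoc (dirProj D),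
        dirProj_mul_transpose_mul_dirProj hDL, Matrix.mul_assoc]
    have hAT : dirLaplacian D * (bdryMatrix n)ᵀ = 0 := by
      rw [dirLaplacian, Matrix.mul_assoc, hTT, Matrix.mul_zero]
    rw [hw, mulVec_mulVec, hAL, mulVec_add, mulVec_neg, mulVec_mulVec, hAT, zero_mulVec, neg_zero,
      zero_add]
  by_cases hw0 : w = 0
  · have hy : y = 0 := by simpa [hw0, hlam] using h2.symm
    have hx : x₁ - x₀ = 0 := by simpa [← hAw, hw0, hlam] using hs
    have hx₀ : x₀ = 0 := by
      have : (2 : ℝ) • x₀ = 0 := by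
        rw [two_smul]
        nth_rw 2 [← sub_eq_zero.mp hx]
        exact hu
      simpa using this
    have hx₁ : x₁ = 0 := by rw [sub_eq_zero.mp hx, hx₀]
    simp [hx₀, hx₁, hy] at hc'
  have hLA : dirProj L * dirLaplacian D = dirLaplacian D := by
    rw [dirLaplacian, ← Matrix.mul_assoc, dirProj_mul_bdryMatrix_mul_dirProj hDL]
  have hLw : dirProj L *ᵥ w = w := by rw [hw, mulVec_mulVec, dirProj_mul_self]
  have hmain : dirLaplacian D *ᵥ w + dirProj L *ᵥ (bdryMatrix n)ᵀ *ᵥ bdryMatrix n *ᵥ w =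
      (lam - 2) • w := by
    have : lam • w = dirProj L *ᵥ (-((bdryMatrix n)ᵀ *ᵥ (lam • y)) + lam • (x₁ - x₀)) := by
      conv_lhs => rw [hw]
      rw [mulVec_smul, ← smul_neg, ← smul_add, mulVec_smul]
    rw [sub_smul, this, ← h2, hs, mulVec_neg, neg_neg, mulVec_add, mulVec_add, mulVec_smul, hLw,
      mulVec_mulVec _ (dirProj L) (dirLaplacian D), hLA, hAw]
    abel
  obtain ⟨m, hm⟩ : ∃ m : ℤ, lam - 2 = m := by
    rcases eigenvalue_of_dirLaplacian_add hDL hw0 hmain with h | ⟨v, hv, h⟩ | ⟨v, hv, h⟩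
    · exact ⟨0, by simpa using h⟩
    · exact ih D hD v _ hv h
    · exact ih L hL v _ hv h
  exact ⟨m + 2, by push_cast; linarith⟩

end Recursion

lemma exists_int_of_dirLaplacian {n : ℕ} (K : Set (Finset (Fin n))) (hK : IsShiftedFamily K)
    (v : Face n → ℝ) (μ : ℝ) (hv : v ≠ 0) (h : dirLaplacian K *ᵥ v = μ • v) :
    ∃ m : ℤ, μ = m := by
  induction n generalizing μ with
  | zero =>
    have hM : bdryMatrix 0 = 0 := by ext f g; simp [bdryMatrix, eps]
    rw [dirLaplacian, hM, Matrix.zero_mul, Matrix.zero_mul, zero_mulVec] at h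
    exact ⟨0, by simpa [hv] using h.symm⟩
  | succ n ih => exact exists_int_of_dirLaplacian_succ hK hv h fun K' hK' v μ => ih K' hK' v μ

section Sorting

variable {α : Type*} [LinearOrder α]

lemma forall₂_le_orderedInsert_of_le {a j : α} {l : List α} (hl : (a :: l).Pairwise (· ≤ ·))
    (haj : a ≤ j) : List.Forall₂ (· ≤ ·) (a :: l) (l.orderedInsert (· ≤ ·) j) := by
  induction l generalizing a with
  | nil => simpa using haj
  | cons b l ih =>
    rw [List.orderedInsert_cons]
    split_ifs with hjb
    · exact .cons haj (List.forall₂_refl _)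
    · exact .cons ((List.pairwise_cons.mp hl).1 b (by simp))
        (ih (List.pairwise_cons.mp hl).2 (le_of_not_ge hjb))

lemma forall₂_orderedInsert_orderedInsert {i j : α} {l : List α} (hl : l.Pairwise (· ≤ ·))
    (hij : i ≤ j) :
    List.Forall₂ (· ≤ ·) (l.orderedInsert (· ≤ ·) i) (l.orderedInsert (· ≤ ·) j) := by
  induction l with
  | nil => simpa using hij
  | cons a l ih =>
    rw [List.orderedInsert_cons, List.orderedInsert_cons]
    split_ifs with hia hja hja
    · exact .cons hij (List.forall₂_refl _)
    · exact .cons hia (forall₂_le_orderedInsert_of_le hl (le_of_not_ge hja))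
    · exact absurd (hij.trans hja) hia
    · exact .cons le_rfl (ih (List.pairwise_cons.mp hl).2)

lemma sort_insert_eq_orderedInsert {i : α} {S : Finset α} (hi : i ∉ S) :
    (insert i S).sort (· ≤ ·) = (S.sort (· ≤ ·)).orderedInsert (· ≤ ·) i := by
  refine List.Perm.eq_of_pairwise' (r := (· ≤ ·)) (Finset.pairwise_sort _ _)
    ((Finset.pairwise_sort _ _).orderedInsert _ _) ?_
  refine List.Perm.trans ?_ (List.perm_orderedInsert _ _ _).symm
  rw [← Multiset.coe_eq_coe, ← Multiset.cons_coe, Finset.sort_eq, Finset.sort_eq,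
    Finset.insert_val_of_notMem hi]

end Sorting

section Restriction

variable {n : ℕ} {X : Finset (Face n)} {k : ℕ}

/-- The direction sets of the `k`-dimensional faces of `X`. -/
def faceDirs (X : Finset (Face n)) (k : ℕ) : Set (Finset (Fin n)) :=
  {S | ∃ g ∈ faceSet X k, dir g = S}

lemma mem_faceSet {f : Face n} : f ∈ faceSet X k ↔ f ∈ X ∧ fdim f = k := by
  simp [faceSet]

lemma dir_mem_faceDirs (hX : IsShifted X) {f : Face n} :
    dir f ∈ faceDirs X k ↔ f ∈ faceSet X k := by
  refine ⟨?_, fun h => ⟨f, h, rfl⟩⟩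
  rintro ⟨g, hg, hgf⟩
  rw [mem_faceSet] at hg ⊢
  have hdim : fdim g = fdim f := by rw [fdim, fdim, hgf]
  exact ⟨hX.2.2.1 g f hdim hg.1 hgf, hdim ▸ hg.2⟩

lemma exists_face_dir_eq (S : Finset (Fin n)) : ∃ f : Face n, dir f = S := by
  refine ⟨fun i => if i ∈ S then 2 else 0, ?_⟩
  ext i
  simp [dir]

lemma isShiftedFamily_faceDirs (hX : IsShifted X) : IsShiftedFamily (faceDirs X k) := by
  rintro _ ⟨g, hg, rfl⟩ j hj i hi hij
  obtain ⟨f, hf⟩ := exists_face_dir_eq (insert i ((dir g).erase j))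
  have hi' : i ∉ (dir g).erase j := fun h => hi (Finset.mem_of_mem_erase h)
  have hdim : fdim f = fdim g := by
    rw [fdim, fdim, hf, Finset.card_insert_of_notMem hi', Finset.card_erase_add_one hj]
  rw [mem_faceSet] at hg
  refine ⟨f, mem_faceSet.mpr ⟨hX.2.2.2 f g hdim hg.1 ?_, hdim.trans hg.2⟩, hf⟩
  rw [hf, sort_insert_eq_orderedInsert hi', ← Finset.insert_erase hj,
    sort_insert_eq_orderedInsert (Finset.notMem_erase j _), Finset.insert_erase hj]
  exact forall₂_orderedInsert_orderedInsert (Finset.pairwise_sort _ _) hij.le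

lemma erase_mem_faceDirs (hX : IsShifted X) :
    ∀ S ∈ faceDirs X (k + 1), ∀ a ∈ S, S.erase a ∈ faceDirs X k := by
  rintro _ ⟨g, hg, rfl⟩ a ha
  rw [mem_faceSet] at hg
  have ha2 : g a = 2 := by simpa [dir] using ha
  have hdir : dir (Function.update g a 0) = (dir g).erase a := by
    ext b
    by_cases hb : b = a
    · subst hb
      simp [dir]
    · simp [dir, hb]
  refine ⟨Function.update g a 0, mem_faceSet.mpr ⟨hX.1 g hg.1 _ fun b hb => ?_, ?_⟩, hdir⟩
  · rw [Function.update_of_ne (by rintro rfl; exact hb ha2)]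
  · rw [fdim, hdir, Finset.card_erase_of_mem ha, ← fdim, hg.2, Nat.add_sub_cancel]

/-- Extension by zero of a vector on the `k`-dimensional faces of `X` to the whole cube. -/
noncomputable def extendZero (v : {f // f ∈ faceSet X k} → ℝ) : Face n → ℝ :=
  Function.extend Subtype.val v 0

lemma extendZero_apply (v : {f // f ∈ faceSet X k} → ℝ) (f : {f // f ∈ faceSet X k}) :
    extendZero v f.1 = v f :=
  Subtype.val_injective.extend_apply _ _ _

lemma extendZero_of_notMem (v : {f // f ∈ faceSet X k} → ℝ) {f : Face n}
    (hf : f ∉ faceSet X k) : extendZero v f = 0 :=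
  Function.extend_apply' _ _ _ (by rintro ⟨x, rfl⟩; exact hf x.2)

lemma extendZero_injective : Function.Injective (extendZero (X := X) (k := k)) := fun v w h =>
  funext fun f => by rw [← extendZero_apply v, h, extendZero_apply]

lemma extendZero_zero : extendZero (0 : {f // f ∈ faceSet X k} → ℝ) = 0 :=
  Function.extend_zero _

lemma extendZero_smul (r : ℝ) (v : {f // f ∈ faceSet X k} → ℝ) :
    extendZero (r • v) = r • extendZero v := by
  simpa [extendZero] using Function.extend_smul r Subtype.val v 0

lemma extendZero_add (v w : {f // f ∈ faceSet X k} → ℝ) :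
    extendZero (v + w) = extendZero v + extendZero w := by
  simpa [extendZero] using Function.extend_add Subtype.val v w 0 0

lemma sum_mul_extendZero (F : Face n → ℝ) (v : {f // f ∈ faceSet X k} → ℝ) :
    ∑ f, F f * extendZero v f = ∑ f : {f // f ∈ faceSet X k}, F f.1 * v f := by
  symm
  refine Fintype.sum_of_injective Subtype.val Subtype.val_injective _ _ (fun f hf => ?_)
    fun f => by rw [extendZero_apply]
  rw [extendZero_of_notMem v (by simpa using hf), mul_zero]

lemma bdryMatrix_mulVec_extendZero (hX : IsShifted X) (v : {f // f ∈ faceSet X (k + 1)} → ℝ) :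
    bdryMatrix n *ᵥ extendZero v = extendZero (bdryM X k *ᵥ v) := by
  funext f
  rw [mulVec, dotProduct, sum_mul_extendZero]
  by_cases hf : f ∈ faceSet X k
  · rw [extendZero_apply _ ⟨f, hf⟩]
    rfl
  · rw [extendZero_of_notMem _ hf]
    refine Finset.sum_eq_zero fun g _ => ?_
    have hg := mem_faceSet.mp g.2
    have : eps f g.1 = 0 := by
      by_contra he
      have hdim := fdim_of_eps_ne_zero he
      exact hf (mem_faceSet.mpr ⟨hX.1 _ hg.1 _ (cubeLE_of_eps_ne_zero he), by omega⟩)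
    simp [bdryMatrix, this]

lemma dirProj_mulVec_transpose_mulVec_extendZero (hX : IsShifted X)
    (v : {f // f ∈ faceSet X k} → ℝ) :
    dirProj (faceDirs X (k + 1)) *ᵥ (bdryMatrix n)ᵀ *ᵥ extendZero v =
      extendZero ((bdryM X k)ᵀ *ᵥ v) := by
  funext g
  rw [dirProj, mulVec_diagonal, mulVec, dotProduct, sum_mul_extendZero]
  by_cases hg : g ∈ faceSet X (k + 1)
  · rw [extendZero_apply _ ⟨g, hg⟩, if_pos ((dir_mem_faceDirs hX).mpr hg), one_mul]
    rfl
  · rw [extendZero_of_notMem _ hg, if_neg fun h => hg ((dir_mem_faceDirs hX).mp h), zero_mul]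

lemma dirLaplacian_mulVec_extendZero (hX : IsShifted X) (v : {f // f ∈ faceSet X k} → ℝ) :
    dirLaplacian (faceDirs X (k + 1)) *ᵥ extendZero v = extendZero (Lud X k *ᵥ v) := by
  rw [dirLaplacian, ← mulVec_mulVec, ← mulVec_mulVec,
    dirProj_mulVec_transpose_mulVec_extendZero hX, bdryMatrix_mulVec_extendZero hX, mulVec_mulVec,
    Lud]

end Restriction

lemma exists_mulVec_eq_smul_of_isRoot_charpoly {ι : Type*} [Fintype ι] [DecidableEq ι]
    {A : Matrix ι ι ℝ} {lam : ℝ} (h : A.charpoly.IsRoot lam) :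
    ∃ v, v ≠ 0 ∧ A *ᵥ v = lam • v := by
  rw [Polynomial.IsRoot.def, Matrix.eval_charpoly] at h
  obtain ⟨v, hv, h0⟩ := Matrix.exists_mulVec_eq_zero_iff.mpr h
  refine ⟨v, hv, ?_⟩
  rw [sub_mulVec, sub_eq_zero] at h0
  rw [← h0]
  simp [Matrix.scalar_apply, ← Matrix.smul_one_eq_diagonal, smul_mulVec]

lemma exists_int_of_Lud {n : ℕ} {X : Finset (Face n)} (hX : IsShifted X) {k : ℕ}
    {v : {f // f ∈ faceSet X k} → ℝ} {lam : ℝ} (hv : v ≠ 0) (h : Lud X k *ᵥ v = lam • v) :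
    ∃ m : ℤ, lam = m :=
  exists_int_of_dirLaplacian _ (isShiftedFamily_faceDirs (k := k + 1) hX) (extendZero v) lam
    (fun h0 => hv (extendZero_injective (h0.trans extendZero_zero.symm)))
    (by rw [dirLaplacian_mulVec_extendZero hX, h, extendZero_smul])

lemma exists_int_of_Ltot {n : ℕ} {X : Finset (Face n)} (hX : IsShifted X) {k : ℕ}
    {v : {f // f ∈ faceSet X k} → ℝ} {lam : ℝ} (hv : v ≠ 0) (h : Ltot X k *ᵥ v = lam • v) :
    ∃ m : ℤ, lam = m := by
  cases k with
  | zero => exact exists_int_of_Lud hX hv (by rwa [Ltot, Ldu, add_zero] at h)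
  | succ k =>
    have hv' : extendZero v ≠ 0 := fun h0 =>
      hv (extendZero_injective (h0.trans extendZero_zero.symm))
    have h' := congrArg extendZero h
    rw [Ltot, Ldu, add_mulVec, extendZero_add, extendZero_smul,
      ← dirLaplacian_mulVec_extendZero hX, ← mulVec_mulVec,
      ← dirProj_mulVec_transpose_mulVec_extendZero hX, ← bdryMatrix_mulVec_extendZero hX] at h'
    rcases eigenvalue_of_dirLaplacian_add (erase_mem_faceDirs hX) hv' h' with
      h0 | ⟨w, hw, hw'⟩ | ⟨w, hw, hw'⟩
    · exact ⟨0, by simpa using h0⟩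
    · exact exists_int_of_dirLaplacian _ (isShiftedFamily_faceDirs hX) w lam hw hw'
    · exact exists_int_of_dirLaplacian _ (isShiftedFamily_faceDirs hX) w lam hw hw'

/-- **Shifted cubical complexes are Laplacian integral** (Duval–Klivans–Martin,
Cor. 5.6).  Every eigenvalue (i.e. every real root of the characteristic polynomial) of
`L^ud_k(X)` and of `L^tot_k(X)` is an integer, for every `k`. -/
theorem shifted_laplacian_integral {n : ℕ} (X : Finset (Face n)) (hX : IsShifted X) :
    ∀ k : ℕ,
      (∀ lam : ℝ, (Lud X k).charpoly.IsRoot lam → ∃ m : ℤ, lam = m) ∧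
      (∀ lam : ℝ, (Ltot X k).charpoly.IsRoot lam → ∃ m : ℤ, lam = m) := by
  intro k
  refine ⟨fun lam h => ?_, fun lam h => ?_⟩
  · obtain ⟨v, hv, h⟩ := exists_mulVec_eq_smul_of_isRoot_charpoly h
    exact exists_int_of_Lud hX hv h
  · obtain ⟨v, hv, h⟩ := exists_mulVec_eq_smul_of_isRoot_charpoly h
    exact exists_int_of_Ltot hX hv h

end CubicalPaper
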